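/- Assume a1 ≥ 2 and a2 ≥ 2. Set s_{a1} := r_{a2} and t_0 := r_0, and define the mutation sequences μ_R = μ_{r_{a2-1}} ∘ ⋯ ∘ μ_{r_2} ∘ μ_{r_1}; μ_S = C_{a1} ∘ ⋯ ∘ C_2 ∘ C_1 where C_m = μ_{s_1} ∘ μ_{s_2} ∘ ⋯ ∘ μ_{s_m} (applying μ_{s_m} first); μ_T = D_{a1} ∘ ⋯ ∘ D_2 ∘ D_1 where D_m = μ_{t_{a1-1}} ∘ μ_{t_{a1-2}} ∘ ⋯ ∘ μ_{t_{a1-m}} (applying μ_{t_{a1-m}} first); and μ = μ_R^{-1} ∘ μ_S ∘ μ_T ∘ μ_R, where μ_R^{-1} = μ_{r_1} ∘ μ_{r_2} ∘ ⋯ ∘ μ_{r_{a2-1}}. Let σ be the permutation of the vertices of Q that fixes r_0, r_{a2} and every s_i and t_i, and sends r_i to r_{a2-i} for 1 ≤ i ≤ a2−1. Then μ(B(Q))_{xy} = −B(Q)_{σ(x)σ(y)} for all vertices x, y; that is, the quiver obtained from Q by the mutation sequence μ is the opposite quiver of Q up to the relabeling σ. -/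

import Mathlib

inductive V (a1 a2 : ℕ) : Type where
  | r : Fin (a2 + 1) → V a1 a2
  | s : Fin (a1 - 1) → V a1 a2
  | t : Fin (a1 - 1) → V a1 a2
deriving DecidableEq

/-- The arrows of the quiver `Q = Q[a1, a2]`.  The vertex `V.s j` denotes `s_{j+1}` and
`V.t j` denotes `t_{j+1}`. -/
def Arrow (a1 a2 : ℕ) : V a1 a2 → V a1 a2 → Prop
  | .r i, .r j => ((i : ℕ) + 1 = (j : ℕ)) ∨ ((i : ℕ) = a2 ∧ (j : ℕ) = 0)
  | .s i, .s j => (i : ℕ) + 1 = (j : ℕ)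
  | .s i, .r j => (i : ℕ) = a1 - 2 ∧ (j : ℕ) = a2
  | .r i, .t j => (i : ℕ) = 0 ∧ (j : ℕ) = 0
  | .t i, .t j => (i : ℕ) + 1 = (j : ℕ)
  | _, _ => False

open Classical in
/-- The exchange matrix `B(Q)` of a quiver given by an arrow relation (at most one arrow
between any two vertices): `B x y = #(arrows x → y) - #(arrows y → x)`. -/
noncomputable def BmatOf {a1 a2 : ℕ} (A : V a1 a2 → V a1 a2 → Prop) :
    V a1 a2 → V a1 a2 → ℤ :=
  fun x y => (if A x y then 1 else 0) - (if A y x then 1 else 0)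

noncomputable def Bmat (a1 a2 : ℕ) : V a1 a2 → V a1 a2 → ℤ := BmatOf (Arrow a1 a2)

/-- Fomin–Zelevinsky matrix mutation at the vertex `p`. -/
noncomputable def mutB {a1 a2 : ℕ} (p : V a1 a2) (B : V a1 a2 → V a1 a2 → ℤ) :
    V a1 a2 → V a1 a2 → ℤ :=
  fun x y =>
    if x = p ∨ y = p then - B x y
    else B x y + (|B x p| * B p y + B x p * |B p y|) / 2

/-- Apply a sequence of mutations, the head of the list first. -/
noncomputable def mutSeq {a1 a2 : ℕ} (l : List (V a1 a2)) (B : V a1 a2 → V a1 a2 → ℤ) :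
    V a1 a2 → V a1 a2 → ℤ :=
  l.foldl (fun B p => mutB p B) B

/-- The vertex `r_n` (indices taken mod `a2 + 1`). -/
def rv (a1 a2 : ℕ) (n : ℕ) : V a1 a2 := .r ⟨n % (a2 + 1), Nat.mod_lt n (Nat.succ_pos a2)⟩

/-- The vertex `s_n` for `1 ≤ n ≤ a1 - 1`, with the convention `s_{a1} := r_{a2}`. -/
def sv (a1 a2 : ℕ) (n : ℕ) : V a1 a2 :=
  if h : 1 ≤ n ∧ n ≤ a1 - 1 then .s ⟨n - 1, by omega⟩ else .r (Fin.last a2)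

/-- The vertex `t_n` for `1 ≤ n ≤ a1 - 1`, with the convention `t_0 := r_0`. -/
def tv (a1 a2 : ℕ) (n : ℕ) : V a1 a2 :=
  if h : 1 ≤ n ∧ n ≤ a1 - 1 then .t ⟨n - 1, by omega⟩ else .r 0

/-- The mutation sequence `μ_R = μ_{r_{a2-1}} ∘ ⋯ ∘ μ_{r_2} ∘ μ_{r_1}` (as a list, applied
head first). -/
def Rlist (a1 a2 : ℕ) : List (V a1 a2) :=
  (List.range (a2 - 1)).map (fun m => rv a1 a2 (m + 1))

/-- The mutation sequence `μ_S = C_{a1} ∘ ⋯ ∘ C_2 ∘ C_1` where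
`C_m = μ_{s_1} ∘ μ_{s_2} ∘ ⋯ ∘ μ_{s_m}` (applied `μ_{s_m}` first) and `s_{a1} := r_{a2}`. -/
def Slist (a1 a2 : ℕ) : List (V a1 a2) :=
  ((List.range a1).map (fun m => (List.range (m + 1)).map
      (fun d => sv a1 a2 (m + 1 - d)))).flatten

/-- The mutation sequence `μ_T = D_{a1} ∘ ⋯ ∘ D_2 ∘ D_1` where
`D_m = μ_{t_{a1-1}} ∘ μ_{t_{a1-2}} ∘ ⋯ ∘ μ_{t_{a1-m}}` (applied `μ_{t_{a1-m}}` first) and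
`t_0 := r_0`. -/
def Tlist (a1 a2 : ℕ) : List (V a1 a2) :=
  ((List.range a1).map (fun m => (List.range (m + 1)).map
      (fun d => tv a1 a2 (a1 - (m + 1) + d)))).flatten

/-- The permutation `σ` of the vertices of `Q`: it fixes `r_0`, `r_{a2}` and all `s_i`, `t_i`,
and sends `r_i` to `r_{a2 - i}` for `1 ≤ i ≤ a2 - 1`. -/
def sigmaV (a1 a2 : ℕ) : V a1 a2 → V a1 a2
  | .r j => if h : 1 ≤ (j : ℕ) ∧ (j : ℕ) ≤ a2 - 1 then .r ⟨a2 - (j : ℕ), by omega⟩ else .r j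
  | .s j => .s j
  | .t j => .t j

section Aux

variable {a1 a2 : ℕ}

def EE (a b : V a1 a2) : V a1 a2 → V a1 a2 → ℤ :=
  fun x y => (if x = a ∧ y = b then 1 else 0) - (if y = a ∧ x = b then 1 else 0)

def Off (p : V a1 a2) (R : V a1 a2 → V a1 a2 → ℤ) : Prop := ∀ x, R x p = 0 ∧ R p x = 0

theorem Off.add {p : V a1 a2} {R S : V a1 a2 → V a1 a2 → ℤ} (h : Off p R) (k : Off p S) :
    Off p (R + S) := by
  intro x; simp [h x, k x]

theorem Off.smul {p : V a1 a2} {R : V a1 a2 → V a1 a2 → ℤ} (c : ℤ) (h : Off p R) :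
    Off p (c • R) := by
  intro x; simp [h x]

theorem Off.neg {p : V a1 a2} {R : V a1 a2 → V a1 a2 → ℤ} (h : Off p R) :
    Off p (-R) := by
  intro x; simp [h x]

theorem Off.sum {p : V a1 a2} {s : Finset ℕ} {f : ℕ → V a1 a2 → V a1 a2 → ℤ}
    (h : ∀ i ∈ s, Off p (f i)) : Off p (∑ i ∈ s, f i) := by
  intro x
  constructor
  · simp only [Finset.sum_apply]; exact Finset.sum_eq_zero fun i hi => (h i hi x).1
  · simp only [Finset.sum_apply]; exact Finset.sum_eq_zero fun i hi => (h i hi x).2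

theorem Off.EE {p a b : V a1 a2} (h : a ≠ p) (k : b ≠ p) : Off p (EE a b) := by
  intro x; simp [_root_.EE, h.symm, k.symm]

theorem EE_swap (a b : V a1 a2) : EE a b = - EE b a := by
  ext x y
  simp only [EE, Pi.neg_apply]
  grind

theorem mutB_local {p : V a1 a2} {R : V a1 a2 → V a1 a2 → ℤ} (h : Off p R)
    (X : V a1 a2 → V a1 a2 → ℤ) : mutB p (R + X) = R + mutB p X := by
  ext x y
  simp only [mutB, Pi.add_apply, (h x).1, (h y).2, zero_add]
  by_cases hx : x = p
  · subst hx; simp [(h y).2]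
  · by_cases hy : y = p
    · subst hy; simp [(h x).1]
    · simp [hx, hy]; ring

theorem even_aux (a b : ℤ) : (2:ℤ) ∣ |a| * b + a * |b| := by
  rcases abs_choice a with h | h <;> rcases abs_choice b with k | k <;> rw [h, k]
  · exact ⟨a * b, by ring⟩
  · exact ⟨0, by ring⟩
  · exact ⟨0, by ring⟩
  · exact ⟨- (a * b), by ring⟩

theorem mutB_invol (p : V a1 a2) (B : V a1 a2 → V a1 a2 → ℤ) : mutB p (mutB p B) = B := by
  ext x y
  by_cases hx : x = p
  · simp [mutB, hx]
  · by_cases hy : y = p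
    · simp [mutB, hy]
    · simp only [mutB, hx, hy, or_false, or_true, if_false, if_true, abs_neg]
      have h := even_aux (B x p) (B p y)
      have e : |B x p| * -B p y + -B x p * |B p y| = -(|B x p| * B p y + B x p * |B p y|) := by ring
      rw [e]
      omega

theorem mutSeq_nil (B : V a1 a2 → V a1 a2 → ℤ) : mutSeq [] B = B := rfl

theorem mutSeq_append (l l' : List (V a1 a2)) (B : V a1 a2 → V a1 a2 → ℤ) :
    mutSeq (l ++ l') B = mutSeq l' (mutSeq l B) := by
  simp [mutSeq, List.foldl_append]

theorem mutSeq_single (p : V a1 a2) (B : V a1 a2 → V a1 a2 → ℤ) :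
    mutSeq [p] B = mutB p B := rfl

theorem mutSeq_reverse (l : List (V a1 a2)) (B : V a1 a2 → V a1 a2 → ℤ) :
    mutSeq l.reverse (mutSeq l B) = B := by
  induction l generalizing B with
  | nil => rfl
  | cons p l ih =>
    have : mutSeq (p :: l) B = mutSeq l (mutB p B) := rfl
    rw [this, List.reverse_cons, mutSeq_append, ih, mutSeq_single, mutB_invol]

theorem sink_aux (u v : ℤ) (h : 0 ≤ u * v) : |u| * (-v) + u * |-v| = 0 := by
  rw [abs_neg]
  rcases le_total 0 u with hu | hu <;> rcases le_total 0 v with hv | hv <;>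
    simp only [abs_of_nonneg, abs_of_nonpos, hu, hv] <;> nlinarith

theorem mutB_sink {p w z : V a1 a2} (hw : w ≠ p) (hz : z ≠ p) (a b : ℤ) (hab : 0 ≤ a * b) :
    mutB p (a • EE w p + b • EE z p) = -(a • EE w p + b • EE z p) := by
  set X := a • EE w p + b • EE z p with hX
  have h1 : ∀ x, x ≠ p → X p x = - X x p := by
    intro x hx; simp [hX, EE, hw.symm, hz.symm, hx]; ring
  have h2 : ∀ x y, x ≠ p → y ≠ p → X x y = 0 := by
    intro x y hx hy; simp [hX, EE, hx, hy]
  have h3 : ∀ x y, x ≠ p → y ≠ p → 0 ≤ X x p * X y p := by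
    intro x y hx hy
    simp only [hX, EE, Pi.add_apply, Pi.smul_apply, hx, and_true, and_false, if_false, sub_zero,
      smul_eq_mul, hy]
    split_ifs <;> simp <;> nlinarith [mul_self_nonneg a, mul_self_nonneg b]
  ext x y
  simp only [mutB, Pi.neg_apply]
  by_cases hx : x = p
  · simp [hx]
  · by_cases hy : y = p
    · simp [hy]
    · simp only [hx, hy, or_false, if_false, h2 x y hx hy, h1 y hy]
      rw [sink_aux _ _ (h3 x y hx hy)]; rfl

theorem mutB_L1 {p x z : V a1 a2} (hx : x ≠ p) (hz : z ≠ p) (hxz : x ≠ z) :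
    mutB p (EE x p + EE p z) = EE x z + EE p x + EE z p := by
  ext a b
  by_cases ha : a = p
  · subst ha
    simp [mutB, EE, hx.symm, hz.symm]; try grind
  · by_cases hb : b = p
    · subst hb
      simp [mutB, EE, hx.symm, hz.symm]; try grind
    · simp [mutB, EE, ha, hb, hx.symm, hz.symm]
      by_cases h1 : a = x <;> by_cases h2 : a = z <;> by_cases h3 : b = x <;> by_cases h4 : b = z <;>
       simp_all

theorem mutB_L2 {p x z w : V a1 a2} (hx : x ≠ p) (hz : z ≠ p) (hw : w ≠ p)
    (hxz : x ≠ z) (hxw : x ≠ w) (hzw : z ≠ w) :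
    mutB p (EE x p + EE p z + EE p w) = EE x z + EE x w + EE p x + EE z p + EE w p := by
  ext a b
  by_cases ha : a = p
  · subst ha
    simp [mutB, EE, hx.symm, hz.symm, hw.symm]; try grind
  · by_cases hb : b = p
    · subst hb
      simp [mutB, EE, hx.symm, hz.symm, hw.symm]; try grind
    · have e1 := hxz.symm
      have e2 := hxw.symm
      have e3 := hzw.symm
      simp [mutB, EE, ha, hb, hx.symm, hz.symm, hw.symm]
      by_cases h1 : a = x
      · by_cases h3 : b = z
        · simp_all
        · by_cases h4 : b = w
          · simp_all
          · simp_all; split_ifs <;> simp_all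
      · by_cases h3 : a = z
        · by_cases h4 : b = x
          · simp_all
          · simp_all; split_ifs <;> simp_all
        · by_cases h5 : a = w
          · by_cases h4 : b = x
            · simp_all
            · simp_all; split_ifs <;> simp_all
          · simp_all

/-! The chain lemma. -/
theorem chain_step (n : ℕ) (u : ℕ → V a1 a2) (hu : ∀ i j, i ≤ n → j ≤ n → u i = u j → i = j)
    (hn : u (n+1) ≠ u n) (R : V a1 a2 → V a1 a2 → ℤ) (j : ℕ) (hj : j < n)
    (hR : Off (u (j+1)) R)
    (e e' : ℕ → ℤ) (he : e n = 0) (h0 : e' j = - e j) (h1 : e' (j+1) = - e (j+1))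
    (h2 : ∀ i, i ≠ j → i ≠ j+1 → e' i = e i) (hs : e j * e (j+1) ≤ 0) :
    mutB (u (j+1)) (R + ∑ i ∈ Finset.range (n+1), e i • EE (u i) (u (i+1))) =
      R + ∑ i ∈ Finset.range (n+1), e' i • EE (u i) (u (i+1)) := by
  have split : ∀ f : ℕ → V a1 a2 → V a1 a2 → ℤ, ∑ i ∈ Finset.range (n+1), f i =
      ∑ i ∈ ((Finset.range (n+1)).erase j).erase (j+1), f i + (f j + f (j+1)) := by
    intro f
    rw [← Finset.sum_erase_add (Finset.range (n+1)) f (a := j) (by simp; omega),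
      ← Finset.sum_erase_add ((Finset.range (n+1)).erase j) f (a := j+1) (by simp; omega)]
    abel
  rw [split, split]
  have hsum : ∑ i ∈ ((Finset.range (n+1)).erase j).erase (j+1), e' i • EE (u i) (u (i+1))
    = ∑ i ∈ ((Finset.range (n+1)).erase j).erase (j+1), e i • EE (u i) (u (i+1)) := by
    apply Finset.sum_congr rfl
    intro i hi
    simp at hi
    rw [h2 i hi.2.1 hi.1]
  rw [hsum, h0, h1, ← add_assoc, mutB_local, EE_swap (u (j+1)) (u (j+1+1))]
  · have := mutB_sink (p := u (j+1)) (w := u j) (z := u (j+1+1))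
      (fun h => by have := hu _ _ (by omega) (by omega) h; omega)
      (fun h => by
        rcases Nat.lt_or_ge (j+1) n with hl | hl
        · have := hu _ _ (by omega) (by omega) h; omega
        · have : j + 1 = n := by omega
          rw [this] at h; exact hn h)
      (e j) (-e (j+1)) (by linarith)
    rw [smul_neg, ← neg_smul, this, ← add_assoc]
    simp only [neg_smul, smul_neg, neg_neg, neg_add]
  · apply hR.add
    apply Off.sum
    intro i hi
    simp at hi
    by_cases hin : i = n
    · subst hin; rw [he]; intro x; simp
    · apply Off.smul
      apply Off.EE
      · intro h; have := hu _ _ (by omega) (by omega) h; omega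
      · intro h; have := hu _ _ (by omega) (by omega) h; omega

def ew (n m d : ℕ) (ε : ℤ) (i : ℕ) : ℤ :=
  if n ≤ i then 0 else if i + m + 1 < n ∨ i + m + 1 = n + d then ε else -ε

theorem chain_inner (n : ℕ) (u : ℕ → V a1 a2) (hu : ∀ i j, i ≤ n → j ≤ n → u i = u j → i = j)
    (hn : u (n+1) ≠ u n) (R : V a1 a2 → V a1 a2 → ℤ)
    (hR : ∀ j, 1 ≤ j → j ≤ n → Off (u j) R) (ε : ℤ) (m : ℕ) (hm : m < n) (d : ℕ) (hd : d ≤ m + 1) :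
    mutSeq ((List.range d).map (fun d => u (n - m + d)))
      (R + ∑ i ∈ Finset.range (n+1), ew n m 0 ε i • EE (u i) (u (i+1))) =
      R + ∑ i ∈ Finset.range (n+1), ew n m d ε i • EE (u i) (u (i+1)) := by
  induction d with
  | zero => rfl
  | succ d ih =>
    rw [List.range_succ, List.map_append, mutSeq_append, ih (by omega)]
    simp only [List.map_cons, List.map_nil, mutSeq_single]
    obtain ⟨j, hj⟩ : ∃ j, n - m + d = j + 1 := ⟨n - m + d - 1, by omega⟩
    rw [hj]
    apply chain_step n u hu hn R j (by omega) (hR _ (by omega) (by omega))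
    · simp [ew]
    · unfold ew; split_ifs <;> first | omega | simp
    · unfold ew; split_ifs <;> first | omega | simp
    · intro i h1 h2; unfold ew; split_ifs <;> first | omega | simp
    · unfold ew; split_ifs <;> first | omega | nlinarith [mul_self_nonneg ε]

theorem chain_all (n : ℕ) (u : ℕ → V a1 a2) (hu : ∀ i j, i ≤ n → j ≤ n → u i = u j → i = j)
    (hn : u (n+1) ≠ u n) (R : V a1 a2 → V a1 a2 → ℤ)
    (hR : ∀ j, 1 ≤ j → j ≤ n → Off (u j) R) (ε : ℤ) (m : ℕ) (hm : m ≤ n) :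
    mutSeq (((List.range m).map (fun m => (List.range (m+1)).map (fun d => u (n - m + d)))).flatten)
      (R + ∑ i ∈ Finset.range (n+1), ew n 0 0 ε i • EE (u i) (u (i+1))) =
      R + ∑ i ∈ Finset.range (n+1), ew n m 0 ε i • EE (u i) (u (i+1)) := by
  induction m with
  | zero => rfl
  | succ m ih =>
    rw [List.range_succ, List.map_append, List.flatten_append, mutSeq_append, ih (by omega)]
    simp only [List.map_cons, List.map_nil, List.flatten_cons, List.flatten_nil, List.append_nil]
    rw [chain_inner n u hu hn R hR ε m (by omega) (m+1) le_rfl]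
    congr 1
    apply Finset.sum_congr rfl
    intro i hi
    congr 1
    unfold ew; split_ifs <;> first | omega | simp

theorem chain (n : ℕ) (u : ℕ → V a1 a2) (hu : ∀ i j, i ≤ n → j ≤ n → u i = u j → i = j)
    (hn : u (n+1) ≠ u n) (R : V a1 a2 → V a1 a2 → ℤ)
    (hR : ∀ j, 1 ≤ j → j ≤ n → Off (u j) R) (ε : ℤ) :
    mutSeq (((List.range n).map (fun m => (List.range (m+1)).map (fun d => u (n - m + d)))).flatten)
      (R + ε • ∑ i ∈ Finset.range n, EE (u i) (u (i+1))) =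
      R + (-ε) • ∑ i ∈ Finset.range n, EE (u i) (u (i+1)) := by
  have h := chain_all n u hu hn R hR ε n le_rfl
  rw [Finset.sum_range_succ, Finset.sum_range_succ] at h
  have e1 : ∀ m, ew n m 0 ε n = 0 := by intro m; simp [ew]
  rw [e1, e1, zero_smul, add_zero, add_zero] at h
  rw [Finset.smul_sum, Finset.smul_sum]
  have e2 : ∑ i ∈ Finset.range n, ew n 0 0 ε i • EE (u i) (u (i+1)) =
      ∑ i ∈ Finset.range n, ε • EE (u i) (u (i+1)) := by
    apply Finset.sum_congr rfl
    intro i hi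
    simp at hi
    congr 1
    unfold ew; split_ifs <;> first | omega | rfl
  have e3 : ∑ i ∈ Finset.range n, ew n n 0 ε i • EE (u i) (u (i+1)) =
      ∑ i ∈ Finset.range n, (-ε) • EE (u i) (u (i+1)) := by
    apply Finset.sum_congr rfl
    intro i hi
    simp at hi
    congr 1
    unfold ew; split_ifs <;> first | omega | rfl
  rw [e2, e3] at h
  exact h

/-! The cycle lemma. -/
theorem cyc_aux (k : ℕ) (c : ℕ → V a1 a2)
    (hc : ∀ i j, i ≤ k+1 → j ≤ k+1 → c i = c j → i = j) (R : V a1 a2 → V a1 a2 → ℤ)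
    (hR : ∀ j, 1 ≤ j → j ≤ k → Off (c j) R) (j : ℕ) (hj : j < k) :
    mutSeq ((List.range (j+1)).map (fun m => c (m+1)))
      (R + ∑ i ∈ Finset.Ico 0 (k+1), EE (c i) (c (i+1))) =
    R + (∑ i ∈ Finset.Ico 1 (j+1), EE (c i) (c (i+1)) + EE (c (j+1)) (c 0) + EE (c 0) (c (j+2))
      + EE (c (j+2)) (c (j+1)) + ∑ i ∈ Finset.Ico (j+2) (k+1), EE (c i) (c (i+1))) := by
  have ne : ∀ i j, i ≤ k+1 → j ≤ k+1 → i ≠ j → c i ≠ c j := fun i j h1 h2 h3 h => h3 (hc i j h1 h2 h)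
  induction j with
  | zero =>
    simp only [zero_add, List.range_one, List.map_cons, List.map_nil, mutSeq_single]
    rw [Finset.sum_eq_sum_Ico_succ_bot (by omega), Finset.sum_eq_sum_Ico_succ_bot (by omega)]
    have e : R + (EE (c 0) (c (0+1)) + (EE (c (0+1)) (c (0+1+1)) +
        ∑ i ∈ Finset.Ico (0+1+1) (k+1), EE (c i) (c (i+1)))) =
        (R + ∑ i ∈ Finset.Ico (0+1+1) (k+1), EE (c i) (c (i+1))) +
        (EE (c 0) (c 1) + EE (c 1) (c 2)) := by simp only [zero_add]; abel
    rw [e, mutB_local, mutB_L1]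
    · simp; abel
    · exact ne _ _ (by omega) (by omega) (by omega)
    · exact ne _ _ (by omega) (by omega) (by omega)
    · exact ne _ _ (by omega) (by omega) (by omega)
    · apply (hR _ le_rfl (by omega)).add
      apply Off.sum
      intro i hi
      simp at hi
      exact Off.EE (ne _ _ (by omega) (by omega) (by omega)) (ne _ _ (by omega) (by omega) (by omega))
  | succ j ih =>
    rw [List.range_succ, List.map_append, mutSeq_append, ih (by omega)]
    simp only [List.map_cons, List.map_nil, mutSeq_single]
    rw [Finset.sum_eq_sum_Ico_succ_bot (a := j+2) (by omega), Finset.sum_Ico_succ_top (b := j + 1) (by omega)]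
    have e : R + (∑ i ∈ Finset.Ico 1 (j+1), EE (c i) (c (i+1)) + EE (c (j+1)) (c 0) + EE (c 0) (c (j+2))
      + EE (c (j+2)) (c (j+1)) + (EE (c (j+2)) (c (j+2+1)) + ∑ i ∈ Finset.Ico (j+2+1) (k+1), EE (c i) (c (i+1)))) =
      (R + (∑ i ∈ Finset.Ico 1 (j+1), EE (c i) (c (i+1)) + EE (c (j+1)) (c 0) +
       ∑ i ∈ Finset.Ico (j+2+1) (k+1), EE (c i) (c (i+1)))) +
       (EE (c 0) (c (j+2)) + EE (c (j+2)) (c (j+3)) + EE (c (j+2)) (c (j+1))) := by abel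
    rw [e, mutB_local, mutB_L2]
    · rw [EE_swap (c (j+1)) (c 0)]
      simp only [show j + 1 + 2 = j + 3 from rfl, show j + 1 + 1 = j + 2 from rfl, show j + 2 + 1 = j + 3 from rfl]
      abel
    · exact ne _ _ (by omega) (by omega) (by omega)
    · exact ne _ _ (by omega) (by omega) (by omega)
    · exact ne _ _ (by omega) (by omega) (by omega)
    · exact ne _ _ (by omega) (by omega) (by omega)
    · exact ne _ _ (by omega) (by omega) (by omega)
    · exact ne _ _ (by omega) (by omega) (by omega)
    · apply (hR _ (by omega) (by omega)).add
      refine Off.add (Off.add (Off.sum ?_) ?_) (Off.sum ?_)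
      · intro i hi
        simp at hi
        exact Off.EE (ne _ _ (by omega) (by omega) (by omega)) (ne _ _ (by omega) (by omega) (by omega))
      · exact Off.EE (ne _ _ (by omega) (by omega) (by omega)) (ne _ _ (by omega) (by omega) (by omega))
      · intro i hi
        simp at hi
        exact Off.EE (ne _ _ (by omega) (by omega) (by omega)) (ne _ _ (by omega) (by omega) (by omega))

theorem cyc (k : ℕ) (hk : 1 ≤ k) (c : ℕ → V a1 a2)
    (hc : ∀ i j, i ≤ k+1 → j ≤ k+1 → c i = c j → i = j) (R : V a1 a2 → V a1 a2 → ℤ)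
    (hR : ∀ j, 1 ≤ j → j ≤ k → Off (c j) R) :
    mutSeq ((List.range k).map (fun m => c (m+1)))
      (R + (∑ i ∈ Finset.range (k+1), EE (c i) (c (i+1)) + EE (c (k+1)) (c 0))) =
    R + (∑ i ∈ Finset.Ico 1 k, EE (c i) (c (i+1)) + EE (c k) (c 0) + EE (c (k+1)) (c k)) := by
  obtain ⟨j, rfl⟩ : ∃ j, k = j + 1 := ⟨k - 1, by omega⟩
  have ne : ∀ i i', i ≤ j+1+1 → i' ≤ j+1+1 → i ≠ i' → c i ≠ c i' :=
    fun i i' h1 h2 h3 h => h3 (hc i i' h1 h2 h)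
  have h := cyc_aux (j+1) c hc (R + EE (c (j+1+1)) (c 0)) (fun i h1 h2 => (hR i h1 h2).add
    (Off.EE (ne _ _ (by omega) (by omega) (by omega)) (ne _ _ (by omega) (by omega) (by omega)))) j
    (by omega)
  rw [Finset.range_eq_Ico]
  have e : R + (∑ i ∈ Finset.Ico 0 (j+1+1), EE (c i) (c (i+1)) + EE (c (j+1+1)) (c 0)) =
    R + EE (c (j+1+1)) (c 0) + ∑ i ∈ Finset.Ico 0 (j+1+1), EE (c i) (c (i+1)) := by abel
  rw [e, h, EE_swap (c (j+1+1)) (c 0)]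
  simp only [show j + 1 + 1 = j + 2 from rfl, Finset.Ico_self, Finset.sum_empty]
  abel

/-! Decomposition of the exchange matrices. -/
theorem BmatOf_or {A A' : V a1 a2 → V a1 a2 → Prop} (h : ∀ x y, A x y → A' x y → False) :
    BmatOf (fun x y => A x y ∨ A' x y) = BmatOf A + BmatOf A' := by
  ext x y
  have h1 := h x y
  have h2 := h y x
  simp only [BmatOf, Pi.add_apply]
  by_cases c1 : A x y <;> by_cases c2 : A' x y <;> by_cases c3 : A y x <;> by_cases c4 : A' y x <;>
    simp_all

theorem BmatOf_single (a b : V a1 a2) : BmatOf (fun x y => x = a ∧ y = b) = EE a b := by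
  ext x y
  simp only [BmatOf, EE]
  congr

theorem BmatOf_swap (A : V a1 a2 → V a1 a2 → Prop) : BmatOf (fun x y => A y x) = - BmatOf A := by
  ext x y
  simp only [BmatOf, Pi.neg_apply]
  ring

theorem BmatOf_path (u : ℕ → V a1 a2) (l n : ℕ) (hln : l ≤ n)
    (hu : ∀ i j, l ≤ i → i ≤ n → l ≤ j → j ≤ n → u i = u j → i = j) :
    BmatOf (fun x y => ∃ i, l ≤ i ∧ i < n ∧ x = u i ∧ y = u (i+1)) =
      ∑ i ∈ Finset.Ico l n, EE (u i) (u (i+1)) := by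
  induction n, hln using Nat.le_induction with
  | base =>
    ext x y
    have : ∀ x y, ¬ (∃ i, l ≤ i ∧ i < l ∧ x = u i ∧ y = u (i+1)) := by
      rintro x y ⟨i, h1, h2, _⟩; omega
    simp [BmatOf, this]
  | succ n hn ih =>
    rw [Finset.sum_Ico_succ_top hn, ← ih (fun i j h1 h2 h3 h4 => hu i j h1 (by omega) h3 (by omega)),
      ← BmatOf_single, ← BmatOf_or]
    · congr 1
      ext x y
      constructor
      · rintro ⟨i, h1, h2, h3⟩
        rcases Nat.lt_or_ge i n with h | h
        · exact Or.inl ⟨i, h1, h, h3⟩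
        · have : i = n := by omega
          subst this; exact Or.inr h3
      · rintro (⟨i, h1, h2, h3⟩ | h)
        · exact ⟨i, h1, by omega, h3⟩
        · exact ⟨n, hn, by omega, h⟩
    · rintro x y ⟨i, h1, h2, h3, _⟩ ⟨h4, _⟩
      have := hu i n h1 (by omega) (by omega) (by omega) (h3 ▸ h4)
      omega

/-! Coding of vertices by integers. -/
def K : V a1 a2 → ℤ
  | .r i => (i : ℕ)
  | .s j => -((j : ℕ) + 1)
  | .t j => a2 + 1 + (j : ℕ)

theorem K_inj {x y : V a1 a2} : x = y ↔ K x = K y := by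
  constructor
  · rintro rfl; rfl
  · rcases x with ⟨i, hi⟩ | ⟨i, hi⟩ | ⟨i, hi⟩ <;> rcases y with ⟨j, hj⟩ | ⟨j, hj⟩ | ⟨j, hj⟩ <;>
      simp only [K, V.r.injEq, V.s.injEq, V.t.injEq, Fin.mk.injEq, reduceCtorEq] <;> omega

def uu (a1 a2 : ℕ) : ℕ → V a1 a2
  | 0 => rv a1 a2 (a2 - 1)
  | i+1 => tv a1 a2 i

def ww (a1 a2 : ℕ) : ℕ → V a1 a2
  | 0 => rv a1 a2 (a2 - 1)
  | i+1 => sv a1 a2 (a1 - i)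

def gg (a2 i : ℕ) : ℕ := if i = 0 then a2 else if i = a2 then 0 else i

theorem K_rv (i : ℕ) (h : i ≤ a2) : K (rv a1 a2 i) = i := by
  simp only [rv, K]
  rw [Nat.mod_eq_of_lt (by omega)]

theorem K_uu (h2 : 1 ≤ a2) (i : ℕ) (h : i ≤ a1) : K (uu a1 a2 i) =
    if i = 0 then (a2 : ℤ) - 1 else if i = 1 then 0 else a2 + i - 1 := by
  rcases i with _ | i
  · simp only [uu, if_true]; rw [K_rv _ (by omega)]; omega
  · simp only [uu, tv]
    split_ifs <;> simp only [K, Fin.val_zero] <;> first | omega | contradiction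

theorem K_ww (h2 : 1 ≤ a2) (i : ℕ) (h : i ≤ a1) : K (ww a1 a2 i) =
    if i = 0 then (a2 : ℤ) - 1 else if i = 1 then (a2 : ℤ) else (i : ℤ) - a1 - 1 := by
  rcases i with _ | i
  · simp only [ww, if_true]; rw [K_rv _ (by omega)]; omega
  · simp only [ww, sv]
    split_ifs <;> simp only [K, Fin.val_last] <;> first | omega | contradiction

theorem gg_le (i : ℕ) (h : i ≤ a2) : gg a2 i ≤ a2 := by
  unfold gg; split_ifs <;> first | omega | contradiction

def PT (a1 a2 : ℕ) (x y : V a1 a2) : Prop :=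
  ∃ i, 1 ≤ i ∧ i < a1 ∧ x = uu a1 a2 i ∧ y = uu a1 a2 (i+1)

def PS (a1 a2 : ℕ) (x y : V a1 a2) : Prop :=
  ∃ i, 1 ≤ i ∧ i < a1 ∧ x = ww a1 a2 i ∧ y = ww a1 a2 (i+1)

def PC (a1 a2 : ℕ) (c : ℕ → V a1 a2) (x y : V a1 a2) : Prop :=
  ∃ i, 0 ≤ i ∧ i < a2 ∧ x = c i ∧ y = c (i+1)

theorem PT_iff (h2 : 1 ≤ a2) (x y : V a1 a2) : PT a1 a2 x y ↔
    ((K x = 0 ∧ K y = a2 + 1) ∨ ((a2:ℤ) + 1 ≤ K x ∧ K y = K x + 1)) ∧ K y < a2 + a1 := by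
  constructor
  · rintro ⟨i, h3, h4, rfl, rfl⟩
    rw [K_uu h2 _ (by omega), K_uu h2 _ (by omega)]
    split_ifs <;> first | omega | contradiction
  · rintro ⟨h | h, h'⟩
    · refine ⟨1, le_rfl, by omega, ?_, ?_⟩ <;> rw [K_inj, K_uu h2 _ (by omega)] <;> simp <;> omega
    · refine ⟨(K x + 1 - a2).toNat, by omega, by omega, ?_, ?_⟩ <;>
        rw [K_inj, K_uu h2 _ (by omega)] <;> split_ifs <;> first | omega | contradiction

theorem PS_iff (h2 : 1 ≤ a2) (x y : V a1 a2) : PS a1 a2 x y ↔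
    ((K x = a2 ∧ K y = 1 - a1) ∨ (K x < 0 ∧ 1 - (a1 : ℤ) ≤ K x ∧ K y = K x + 1)) ∧ K y < 0 := by
  constructor
  · rintro ⟨i, h3, h4, rfl, rfl⟩
    rw [K_ww h2 _ (by omega), K_ww h2 _ (by omega)]
    split_ifs <;> first | omega | contradiction
  · rintro ⟨h | h, h'⟩
    · refine ⟨1, le_rfl, by omega, ?_, ?_⟩ <;> rw [K_inj, K_ww h2 _ (by omega)] <;> simp <;> omega
    · refine ⟨(K x + 1 + a1).toNat, by omega, by omega, ?_, ?_⟩ <;>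
        rw [K_inj, K_ww h2 _ (by omega)] <;> split_ifs <;> first | omega | contradiction

theorem PC_iff (x y : V a1 a2) : PC a1 a2 (rv a1 a2) x y ↔
    0 ≤ K x ∧ K y = K x + 1 ∧ K y ≤ a2 := by
  constructor
  · rintro ⟨i, h3, h4, rfl, rfl⟩
    rw [K_rv _ (by omega), K_rv _ (by omega)]
    omega
  · rintro h
    refine ⟨(K x).toNat, by omega, by omega, ?_, ?_⟩ <;> rw [K_inj, K_rv _ (by omega)] <;> omega

theorem PC'_iff (h2 : 2 ≤ a2) (x y : V a1 a2) : PC a1 a2 (fun i => rv a1 a2 (gg a2 i)) x y ↔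
    (K x = a2 ∧ K y = 1) ∨ (K x = a2 - 1 ∧ K y = 0) ∨ (1 ≤ K x ∧ K y = K x + 1 ∧ K y < a2) := by
  constructor
  · rintro ⟨i, h3, h4, rfl, rfl⟩
    simp only
    rw [K_rv _ (gg_le _ (by omega)), K_rv _ (gg_le _ (by omega))]
    unfold gg
    split_ifs <;> first | omega | contradiction
  · rintro (h | h | h)
    · refine ⟨0, by omega, by omega, ?_, ?_⟩ <;> rw [K_inj, K_rv _ (gg_le _ (by omega))] <;>
        unfold gg <;> split_ifs <;> first | omega | contradiction
    · refine ⟨a2 - 1, by omega, by omega, ?_, ?_⟩ <;> rw [K_inj, K_rv _ (gg_le _ (by omega))] <;>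
        unfold gg <;> split_ifs <;> first | omega | contradiction
    · refine ⟨(K x).toNat, by omega, by omega, ?_, ?_⟩ <;>
        rw [K_inj, K_rv _ (gg_le _ (by omega))] <;> unfold gg <;> split_ifs <;> first | omega | contradiction

theorem Arrow_iff (h1 : 2 ≤ a1) (h2 : 2 ≤ a2) (x y : V a1 a2) : Arrow a1 a2 x y ↔
    (PC a1 a2 (rv a1 a2) x y ∨ (x = rv a1 a2 a2 ∧ y = rv a1 a2 0)) ∨
      (PT a1 a2 x y ∨ PS a1 a2 y x) := by
  rw [PC_iff, PT_iff (by omega), PS_iff (by omega), K_inj (y := rv a1 a2 a2),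
    K_inj (y := rv a1 a2 0), K_rv _ (by omega), K_rv _ (by omega)]
  rcases x with ⟨i, hi⟩ | ⟨i, hi⟩ | ⟨i, hi⟩ <;> rcases y with ⟨j, hj⟩ | ⟨j, hj⟩ | ⟨j, hj⟩ <;>
      simp only [K, Arrow] <;> first | omega | (simp only [false_iff]; omega)

theorem K_sigma (x : V a1 a2) : K (sigmaV a1 a2 x) =
    if 1 ≤ K x ∧ K x < a2 then a2 - K x else K x := by
  rcases x with ⟨i, hi⟩ | ⟨i, hi⟩ | ⟨i, hi⟩ <;> simp only [sigmaV]
  · by_cases h : 1 ≤ i ∧ i ≤ a2 - 1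
    · rw [dif_pos h]; split_ifs with h' <;> simp only [K] at * <;> omega
    · rw [dif_neg h]; split_ifs with h' <;> simp only [K] at * <;> omega
  · split_ifs with h' <;> simp only [K] at * <;> omega
  · split_ifs with h' <;> simp only [K] at * <;> omega

set_option maxHeartbeats 4000000 in
theorem Arrow_sigma_iff (h1 : 2 ≤ a1) (h2 : 2 ≤ a2) (x y : V a1 a2) :
    Arrow a1 a2 (sigmaV a1 a2 y) (sigmaV a1 a2 x) ↔
    (PC a1 a2 (fun i => rv a1 a2 (gg a2 i)) x y ∨
        (x = rv a1 a2 (gg a2 a2) ∧ y = rv a1 a2 (gg a2 0))) ∨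
      (PT a1 a2 y x ∨ PS a1 a2 x y) := by
  rw [Arrow_iff h1 h2, PC'_iff h2, PC_iff, PT_iff (by omega), PS_iff (by omega),
    PT_iff (by omega), PS_iff (by omega), K_inj (y := rv a1 a2 a2),
    K_inj (y := rv a1 a2 0), K_inj (y := rv a1 a2 (gg a2 a2)),
    K_inj (y := rv a1 a2 (gg a2 0)), K_rv _ (by omega), K_rv _ (by omega),
    K_rv _ (gg_le _ (by omega)), K_rv _ (gg_le _ (by omega)), K_sigma, K_sigma]
  have e1 : gg a2 a2 = 0 := by unfold gg; split_ifs <;> first | omega | contradiction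
  have e2 : gg a2 0 = a2 := by simp [gg]
  rw [e1, e2]
  have bx : 1 - (a1:ℤ) ≤ K x ∧ K x < a2 + a1 := by
    rcases x with ⟨i, hi⟩ | ⟨i, hi⟩ | ⟨i, hi⟩ <;> simp only [K] <;> omega
  have hby : 1 - (a1:ℤ) ≤ K y ∧ K y < a2 + a1 := by
    rcases y with ⟨i, hi⟩ | ⟨i, hi⟩ | ⟨i, hi⟩ <;> simp only [K] <;> omega
  generalize K x = X at *
  generalize K y = Y at *
  clear e1 e2
  constructor <;> intro h
  · split_ifs at h <;> omega
  · split_ifs <;> omega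

theorem uu_inj (h2 : 2 ≤ a2) : ∀ i j, i ≤ a1 → j ≤ a1 → uu a1 a2 i = uu a1 a2 j → i = j := by
  intro i j hi hj h
  rw [K_inj, K_uu (by omega) _ hi, K_uu (by omega) _ hj] at h
  split_ifs at h <;> first | omega | contradiction

theorem ww_inj (h2 : 2 ≤ a2) : ∀ i j, i ≤ a1 → j ≤ a1 → ww a1 a2 i = ww a1 a2 j → i = j := by
  intro i j hi hj h
  rw [K_inj, K_ww (by omega) _ hi, K_ww (by omega) _ hj] at h
  split_ifs at h <;> first | omega | contradiction

theorem rv_inj : ∀ i j, i ≤ a2 → j ≤ a2 → rv a1 a2 i = rv a1 a2 j → i = j := by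
  intro i j hi hj h
  rw [K_inj, K_rv _ hi, K_rv _ hj] at h
  omega

theorem gv_inj : ∀ i j, i ≤ a2 → j ≤ a2 → rv a1 a2 (gg a2 i) = rv a1 a2 (gg a2 j) → i = j := by
  intro i j hi hj h
  have := rv_inj _ _ (gg_le _ hi) (gg_le _ hj) h
  unfold gg at this
  split_ifs at this <;> first | omega | contradiction

theorem uu_ne_ww (h2 : 2 ≤ a2) (i j : ℕ) (hi : i ≤ a1) (hj : j ≤ a1) (h : 1 ≤ i ∨ 1 ≤ j) :
    uu a1 a2 i ≠ ww a1 a2 j := by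
  intro h
  rw [K_inj, K_uu (by omega) _ hi, K_ww (by omega) _ hj] at h
  split_ifs at h <;> first | omega | contradiction

theorem rv_ne_uu (h2 : 2 ≤ a2) (i j : ℕ) (h0 : 1 ≤ i) (hi : i < a2) (hj : j ≤ a1) (h : 1 ≤ j) :
    rv a1 a2 i ≠ uu a1 a2 j := by
  intro h
  rw [K_inj, K_rv _ (by omega), K_uu (by omega) _ hj] at h
  split_ifs at h <;> first | omega | contradiction

theorem rv_ne_ww (h2 : 2 ≤ a2) (i j : ℕ) (h0 : 1 ≤ i) (hi : i < a2) (hj : j ≤ a1) (h : 1 ≤ j) :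
    rv a1 a2 i ≠ ww a1 a2 j := by
  intro h
  rw [K_inj, K_rv _ (by omega), K_ww (by omega) _ hj] at h
  split_ifs at h <;> first | omega | contradiction

theorem Bmat_eq (h1 : 2 ≤ a1) (h2 : 2 ≤ a2) : Bmat a1 a2 =
    (∑ i ∈ Finset.Ico 1 a1, EE (uu a1 a2 i) (uu a1 a2 (i+1)) +
      -∑ i ∈ Finset.Ico 1 a1, EE (ww a1 a2 i) (ww a1 a2 (i+1))) +
    (∑ i ∈ Finset.range a2, EE (rv a1 a2 i) (rv a1 a2 (i+1)) +
      EE (rv a1 a2 a2) (rv a1 a2 0)) := by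
  have : Arrow a1 a2 = fun x y => (PC a1 a2 (rv a1 a2) x y ∨ (x = rv a1 a2 a2 ∧ y = rv a1 a2 0)) ∨
      (PT a1 a2 x y ∨ PS a1 a2 y x) := by
    ext x y; exact Arrow_iff h1 h2 x y
  rw [Bmat, this, BmatOf_or, BmatOf_or, BmatOf_or, BmatOf_single, BmatOf_swap (PS a1 a2), add_comm]
  · unfold PC PT PS
    rw [BmatOf_path, BmatOf_path, BmatOf_path, Finset.range_eq_Ico]
    · omega
    · intro i j _ hi _ hj; exact rv_inj i j hi hj
    · omega
    · intro i j _ hi _ hj; exact ww_inj h2 i j hi hj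
    · omega
    · intro i j _ hi _ hj; exact uu_inj h2 i j hi hj
  · intro x y
    rw [PT_iff (by omega), PS_iff (by omega)]; omega
  · intro x y
    rw [PC_iff, K_inj (y := rv a1 a2 a2),
      K_inj (y := rv a1 a2 0), K_rv _ (by omega), K_rv _ (by omega)]; omega
  · intro x y
    rw [PC_iff, K_inj (y := rv a1 a2 a2),
      K_inj (y := rv a1 a2 0), K_rv _ (by omega), K_rv _ (by omega), PT_iff (by omega),
      PS_iff (by omega)]; omega

theorem Bmat_sigma_eq (h1 : 2 ≤ a1) (h2 : 2 ≤ a2) :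
    (fun x y => - Bmat a1 a2 (sigmaV a1 a2 x) (sigmaV a1 a2 y)) =
    (-∑ i ∈ Finset.Ico 1 a1, EE (uu a1 a2 i) (uu a1 a2 (i+1)) +
      ∑ i ∈ Finset.Ico 1 a1, EE (ww a1 a2 i) (ww a1 a2 (i+1))) +
    (∑ i ∈ Finset.range a2, EE (rv a1 a2 (gg a2 i)) (rv a1 a2 (gg a2 (i+1))) +
      EE (rv a1 a2 (gg a2 a2)) (rv a1 a2 (gg a2 0))) := by
  have e : (fun x y => - Bmat a1 a2 (sigmaV a1 a2 x) (sigmaV a1 a2 y)) =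
      BmatOf (fun x y => Arrow a1 a2 (sigmaV a1 a2 y) (sigmaV a1 a2 x)) := by
    ext x y; simp only [Bmat, BmatOf]; ring
  have : (fun x y => Arrow a1 a2 (sigmaV a1 a2 y) (sigmaV a1 a2 x)) = fun x y =>
     (PC a1 a2 (fun i => rv a1 a2 (gg a2 i)) x y ∨
        (x = rv a1 a2 (gg a2 a2) ∧ y = rv a1 a2 (gg a2 0))) ∨
      (PT a1 a2 y x ∨ PS a1 a2 x y) := by
    ext x y; exact Arrow_sigma_iff h1 h2 x y
  have e1 : gg a2 a2 = 0 := by unfold gg; split_ifs <;> first | omega | contradiction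
  have e2 : gg a2 0 = a2 := by simp [gg]
  rw [e, this, BmatOf_or, BmatOf_or, BmatOf_or, BmatOf_single, BmatOf_swap (PT a1 a2), add_comm]
  · unfold PC PT PS
    rw [BmatOf_path, BmatOf_path, BmatOf_path (fun i => rv a1 a2 (gg a2 i)), Finset.range_eq_Ico]
    · omega
    · intro i j _ hi _ hj; exact gv_inj i j hi hj
    · omega
    · intro i j _ hi _ hj; exact ww_inj h2 i j hi hj
    · omega
    · intro i j _ hi _ hj; exact uu_inj h2 i j hi hj
  · intro x y
    rw [PT_iff (by omega), PS_iff (by omega)]; omega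
  · intro x y
    rw [PC'_iff h2, e1, e2, K_inj (y := rv a1 a2 a2),
      K_inj (y := rv a1 a2 0), K_rv _ (by omega), K_rv _ (by omega)]; omega
  · intro x y
    rw [PC'_iff h2, e1, e2, K_inj (y := rv a1 a2 a2),
      K_inj (y := rv a1 a2 0), K_rv _ (by omega), K_rv _ (by omega), PT_iff (by omega),
      PS_iff (by omega)]; omega

theorem Tlist_eq : Tlist a1 a2 = ((List.range a1).map (fun m => (List.range (m+1)).map
    (fun d => uu a1 a2 (a1 - m + d)))).flatten := by
  unfold Tlist
  congr 1
  apply List.map_congr_left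
  intro m hm
  apply List.map_congr_left
  intro d hd
  simp at hm hd
  rw [show a1 - m + d = (a1 - (m+1) + d) + 1 by omega]
  rfl

theorem Slist_eq : Slist a1 a2 = ((List.range a1).map (fun m => (List.range (m+1)).map
    (fun d => ww a1 a2 (a1 - m + d)))).flatten := by
  unfold Slist
  congr 1
  apply List.map_congr_left
  intro m hm
  apply List.map_congr_left
  intro d hd
  simp at hm hd
  rw [show a1 - m + d = (a1 - (m+1) + d) + 1 by omega, ww]
  congr 1; omega

end Aux

/-- For `a1, a2 ≥ 2`, the mutation sequence
`μ = μ_R⁻¹ ∘ μ_S ∘ μ_T ∘ μ_R` (applied in the order `μ_R`, then `μ_T`, then `μ_S`, then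
`μ_R⁻¹ = μ_{r_1} ∘ ⋯ ∘ μ_{r_{a2-1}}`) satisfies `μ(B(Q))_{x y} = -B(Q)_{σ(x) σ(y)}`:
the quiver obtained from `Q` by `μ` is the opposite quiver of `Q` up to the relabeling
`σ`. -/
theorem statement19 (a1 a2 : ℕ) (ha1 : 2 ≤ a1) (ha2 : 2 ≤ a2) :
    ∀ x y : V a1 a2,
      mutSeq (Rlist a1 a2 ++ Tlist a1 a2 ++ Slist a1 a2 ++ (Rlist a1 a2).reverse)
          (Bmat a1 a2) x y =
        - Bmat a1 a2 (sigmaV a1 a2 x) (sigmaV a1 a2 y) := by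

  have hgR : Rlist a1 a2 = (List.range (a2 - 1)).map (fun m => rv a1 a2 (gg a2 (m + 1))) := by
    unfold Rlist
    apply List.map_congr_left
    intro m hm
    simp at hm
    congr 1
    unfold gg; split_ifs <;> first | omega | contradiction
  obtain ⟨k, rfl⟩ : ∃ k, a2 = k + 1 := ⟨a2 - 1, by omega⟩
  have hT : ∀ j, 1 ≤ j → j ≤ k → Off (rv a1 (k+1) j)
      (∑ i ∈ Finset.Ico 1 a1, EE (uu a1 (k+1) i) (uu a1 (k+1) (i+1))) := by
    intro j h1 h2
    apply Off.sum
    intro i hi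
    simp at hi
    exact Off.EE (rv_ne_uu ha2 _ _ h1 (by omega) (by omega) (by omega)).symm
      (rv_ne_uu ha2 _ _ h1 (by omega) (by omega) (by omega)).symm
  have hS : ∀ j, 1 ≤ j → j ≤ k → Off (rv a1 (k+1) j)
      (∑ i ∈ Finset.Ico 1 a1, EE (ww a1 (k+1) i) (ww a1 (k+1) (i+1))) := by
    intro j h1 h2
    apply Off.sum
    intro i hi
    simp at hi
    exact Off.EE (rv_ne_ww ha2 _ _ h1 (by omega) (by omega) (by omega)).symm
      (rv_ne_ww ha2 _ _ h1 (by omega) (by omega) (by omega)).symm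
  have c1 := cyc k (by omega) (rv a1 (k+1)) rv_inj _ (fun j h1 h2 => (hT j h1 h2).add (hS j h1 h2).neg)
  rw [← Bmat_eq ha1 ha2] at c1
  have hgj : ∀ j, 1 ≤ j → j ≤ k → gg (k+1) j = j := by
    intro j h1 h2; unfold gg; split_ifs <;> first | omega | contradiction
  have c2 := cyc k (by omega) (fun i => rv a1 (k+1) (gg (k+1) i)) gv_inj _
    (fun j h1 h2 => by
      simp only [hgj j h1 h2]
      exact (hT j h1 h2).neg.add (hS j h1 h2))
  rw [← Bmat_sigma_eq ha1 ha2] at c2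
  have hg1 : gg (k+1) (k+1) = 0 := by unfold gg; split_ifs <;> first | omega | contradiction
  have hg2 : gg (k+1) 0 = k+1 := by simp [gg]
  have hP : ∑ i ∈ Finset.Ico 1 k, EE (rv a1 (k+1) (gg (k+1) i)) (rv a1 (k+1) (gg (k+1) (i+1))) =
      ∑ i ∈ Finset.Ico 1 k, EE (rv a1 (k+1) i) (rv a1 (k+1) (i+1)) := by
    apply Finset.sum_congr rfl
    intro i hi
    simp at hi
    rw [hgj i (by omega) (by omega), hgj (i+1) (by omega) (by omega)]
  rw [hP, hg1, hg2, hgj k (by omega) le_rfl] at c2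
  have u0 : uu a1 (k+1) 0 = rv a1 (k+1) k := rfl
  have w0 : ww a1 (k+1) 0 = rv a1 (k+1) k := rfl
  have u1 : uu a1 (k+1) 1 = rv a1 (k+1) 0 := by
    rw [K_inj, K_uu (by omega) _ (by omega), K_rv _ (by omega)]; simp
  have w1 : ww a1 (k+1) 1 = rv a1 (k+1) (k+1) := by
    rw [K_inj, K_ww (by omega) _ (by omega), K_rv _ (by omega)]; simp
  have sU : ∑ i ∈ Finset.range a1, EE (uu a1 (k+1) i) (uu a1 (k+1) (i+1)) =
      EE (rv a1 (k+1) k) (rv a1 (k+1) 0) +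
      ∑ i ∈ Finset.Ico 1 a1, EE (uu a1 (k+1) i) (uu a1 (k+1) (i+1)) := by
    rw [Finset.range_eq_Ico, Finset.sum_eq_sum_Ico_succ_bot (by omega), zero_add, u0, u1]
  have sW : ∑ i ∈ Finset.range a1, EE (ww a1 (k+1) i) (ww a1 (k+1) (i+1)) =
      EE (rv a1 (k+1) k) (rv a1 (k+1) (k+1)) +
      ∑ i ∈ Finset.Ico 1 a1, EE (ww a1 (k+1) i) (ww a1 (k+1) (i+1)) := by
    rw [Finset.range_eq_Ico, Finset.sum_eq_sum_Ico_succ_bot (by omega), zero_add, w0, w1]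
  have hun : uu a1 (k+1) (a1+1) ≠ uu a1 (k+1) a1 := by
    have : uu a1 (k+1) (a1+1) = rv a1 (k+1) 0 := by
      simp only [uu, tv]; rw [dif_neg (by omega)]; rfl
    rw [this, ← u1]
    intro h; have := uu_inj ha2 _ _ (by omega) (by omega) h; omega
  have hwn : ww a1 (k+1) (a1+1) ≠ ww a1 (k+1) a1 := by
    have : ww a1 (k+1) (a1+1) = rv a1 (k+1) (k+1) := by
      simp only [ww, sv]; rw [dif_neg (by omega), K_inj, K_rv _ (by omega)]; simp [K]
    rw [this, ← w1]
    intro h; have := ww_inj ha2 _ _ (by omega) (by omega) h; omega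
  set P := ∑ i ∈ Finset.Ico 1 k, EE (rv a1 (k+1) i) (rv a1 (k+1) (i+1)) with hPdef
  have t1 := chain a1 (uu a1 (k+1)) (uu_inj ha2) hun
    (P + -∑ i ∈ Finset.range a1, EE (ww a1 (k+1) i) (ww a1 (k+1) (i+1)))
    (fun j h1 h2 => by
      apply Off.add (Off.sum _) (Off.neg (Off.sum _))
      · intro i hi
        simp at hi
        exact Off.EE (rv_ne_uu ha2 _ _ (by omega) (by omega) h2 h1)
          (rv_ne_uu ha2 _ _ (by omega) (by omega) h2 h1)
      · intro i hi
        simp at hi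
        exact Off.EE (uu_ne_ww ha2 _ _ (by omega) (by omega) (by omega)).symm
          (uu_ne_ww ha2 _ _ (by omega) (by omega) (by omega)).symm) 1
  have t2 := chain a1 (ww a1 (k+1)) (ww_inj ha2) hwn
    (P + -∑ i ∈ Finset.range a1, EE (uu a1 (k+1) i) (uu a1 (k+1) (i+1)))
    (fun j h1 h2 => by
      apply Off.add (Off.sum _) (Off.neg (Off.sum _))
      · intro i hi
        simp at hi
        exact Off.EE (rv_ne_ww ha2 _ _ (by omega) (by omega) h2 h1)
          (rv_ne_ww ha2 _ _ (by omega) (by omega) h2 h1)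
      · intro i hi
        simp at hi
        exact Off.EE (uu_ne_ww ha2 _ _ (by omega) (by omega) (by omega))
          (uu_ne_ww ha2 _ _ (by omega) (by omega) (by omega))) (-1)
  rw [← Tlist_eq] at t1
  rw [← Slist_eq] at t2
  have hR1 : Rlist a1 (k+1) = (List.range k).map (fun m => rv a1 (k+1) (m+1)) := rfl
  have hR2 : Rlist a1 (k+1) = (List.range k).map (fun m => rv a1 (k+1) (gg (k+1) (m+1))) := hgR
  rw [← hR1] at c1
  rw [← hR2] at c2
  have main : mutSeq (Rlist a1 (k+1) ++ Tlist a1 (k+1) ++ Slist a1 (k+1) ++ (Rlist a1 (k+1)).reverse)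
      (Bmat a1 (k+1)) =
      fun x y => - Bmat a1 (k+1) (sigmaV a1 (k+1) x) (sigmaV a1 (k+1) y) := by
    rw [mutSeq_append, mutSeq_append, mutSeq_append, c1]
    rw [← mutSeq_reverse (Rlist a1 (k+1))
      (fun x y => - Bmat a1 (k+1) (sigmaV a1 (k+1) x) (sigmaV a1 (k+1) y)), c2]
    congr 1
    rw [sU, sW] at t1 t2
    have sw1 := EE_swap (rv a1 (k+1) (k+1)) (rv a1 (k+1) k)
    have sw2 := EE_swap (rv a1 (k+1) 0) (rv a1 (k+1) k)
    rw [sw1, sw2]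
    simp only [neg_smul, one_smul, neg_neg] at t1 t2
    refine Eq.trans (congrArg (mutSeq (Slist a1 (k+1))) ((congrArg (mutSeq (Tlist a1 (k+1))) ?_).trans
      (t1.trans ?_))) (t2.trans ?_)
    all_goals abel
  intro x y
  rw [main]
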